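/- Let t₀ ∈ ℝ, c > 0, E₀ ≥ 0, let V : ℝ → ℝ be differentiable with V(t) ≥ 0 for all t, and let e : ℝ → ℝⁿ be continuous. Suppose that for every t ≥ t₀, if ‖e(s)‖ > E₀ for all s ∈ [t₀, t], then V'(t) ≤ −c. Then there exists t₁ ∈ [t₀, t₀ + V(t₀)/c] such that ‖e(t₁)‖ ≤ E₀. -/

import Mathlib

/-- finite hitting-time estimate: a nonnegative differentiable
Lyapunov function that decreases at uniform rate `c` as long as the error stays
outside the ball of radius `E₀` forces the error to reach that ball no later
than `t₀ + V(t₀)/c`. -/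
theorem hitting_time_estimate
    {n : ℕ} (t₀ c E₀ : ℝ) (hc : 0 < c) (hE₀ : 0 ≤ E₀)
    (V : ℝ → ℝ) (hV : Differentiable ℝ V) (hVnonneg : ∀ t, 0 ≤ V t)
    (e : ℝ → EuclideanSpace ℝ (Fin n)) (he : Continuous e)
    (hdecay : ∀ t, t₀ ≤ t → (∀ s ∈ Set.Icc t₀ t, E₀ < ‖e s‖) → deriv V t ≤ -c) :
    ∃ t₁ ∈ Set.Icc t₀ (t₀ + V t₀ / c), ‖e t₁‖ ≤ E₀ := by
  by_contra! hout
  set T := t₀ + V t₀ / c with hT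
  have hle : t₀ ≤ T := le_add_of_nonneg_right (div_nonneg (hVnonneg t₀) hc.le)
  have hderiv : ∀ t ∈ Set.Icc t₀ T, deriv V t ≤ -c := fun t ht =>
    hdecay t ht.1 fun s hs => hout s ⟨hs.1, hs.2.trans ht.2⟩
  have hdrop : V T - V t₀ ≤ -c * (T - t₀) :=
    (convex_Icc t₀ T).image_sub_le_mul_sub_of_deriv_le hV.continuous.continuousOn
      hV.differentiableOn (fun t ht => hderiv t (interior_subset ht))
      t₀ (Set.left_mem_Icc.2 hle) T (Set.right_mem_Icc.2 hle) hle
  have hVT : V T ≤ 0 := by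
    have hlen : c * (T - t₀) = V t₀ := by
      rw [hT, add_sub_cancel_left, mul_div_cancel₀ _ hc.ne']
    linarith
  have hmin : IsLocalMin V T := Filter.Eventually.of_forall fun t => hVT.trans (hVnonneg t)
  linarith [hmin.deriv_eq_zero, hderiv T (Set.right_mem_Icc.2 hle)]
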